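/- arXiv:2310.12966 — 3 statements merged into one kernel-verified Lean document; each statement's English description precedes it below -/
import Mathlib

section
/- Let (g, ⟨·,·⟩) be a flat Lie algebra. Then there exists an abelian Lie subalgebra 𝔰 of g such that g is the orthogonal direct sum 𝔰 ⊕ 𝔷 ⊕ [g,g], where 𝔷 is the center of g and [g,g] is the commutator ideal; moreover [g,g] is abelian and of even dimension, and for every x ∈ 𝔰 ⊕ 𝔷 and every y ∈ g one has [x,y] = ∇ₓy. -/
namespace LinearMap.BilinForm

variable {V : Type*} [AddCommGroup V] [Module ℝ V] {B : LinearMap.BilinForm ℝ V}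

theorem ext_of_posDef (hpos : ∀ x : V, x ≠ 0 → 0 < B x x) {x y : V}
    (h : ∀ z, B x z = B y z) : x = y := by
  by_contra hxy
  have h1 := hpos (x - y) (sub_ne_zero.mpr hxy)
  rw [map_sub B, LinearMap.sub_apply, h, sub_self] at h1
  exact lt_irrefl _ h1

theorem nonneg_of_posDef (hpos : ∀ x : V, x ≠ 0 → 0 < B x x) (x : V) : 0 ≤ B x x := by
  rcases eq_or_ne x 0 with rfl | hx
  · simp
  · exact (hpos x hx).le

theorem eq_zero_of_posDef (hpos : ∀ x : V, x ≠ 0 → 0 < B x x) {x : V} (h : B x x = 0) :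
    x = 0 := by
  by_contra hx
  exact (hpos x hx).ne' h

theorem isCompl_orthogonal_of_posDef [FiniteDimensional ℝ V] (hsymm : ∀ x y : V, B x y = B y x)
    (hpos : ∀ x : V, x ≠ 0 → 0 < B x x) (W : Submodule ℝ V) :
    IsCompl W (B.orthogonal W) := by
  have hrefl : B.IsRefl := fun x y h => by rw [hsymm, h]
  rw [isCompl_orthogonal_iff_disjoint hrefl, Submodule.disjoint_def]
  exact fun x hx hx' => eq_zero_of_posDef hpos (hx' x hx)

theorem exists_orthonormal_basis [FiniteDimensional ℝ V] (hsymm : ∀ x y : V, B x y = B y x)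
    (hpos : ∀ x : V, x ≠ 0 → 0 < B x x) :
    ∃ v : Module.Basis (Fin (Module.finrank ℝ V)) ℝ V,
      ∀ i j, B (v i) (v j) = if i = j then 1 else 0 := by
  obtain ⟨v, hv⟩ := exists_orthogonal_basis (B := B) ⟨hsymm⟩
  have hp : ∀ i, 0 < B (v i) (v i) := fun i => hpos _ (v.ne_zero i)
  have hu : ∀ i, IsUnit ((√(B (v i) (v i)))⁻¹) := fun i =>
    (inv_ne_zero (Real.sqrt_pos.mpr (hp i)).ne').isUnit
  refine ⟨v.isUnitSMul hu, fun i j => ?_⟩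
  simp only [Module.Basis.isUnitSMul_apply, map_smul, LinearMap.smul_apply, smul_eq_mul]
  split_ifs with h
  · subst h
    have h1 := Real.mul_self_sqrt (hp i).le
    have h2 := (Real.sqrt_pos.mpr (hp i)).ne'
    field_simp
    nlinarith
  · rw [show B (v i) (v j) = 0 from hv h]
    simp

variable {ι : Type*} [Fintype ι] [DecidableEq ι] {v : Module.Basis ι ℝ V}

theorem repr_of_orthonormal (hv : ∀ i j, B (v i) (v j) = if i = j then 1 else 0) (x : V) (i : ι) :
    v.repr x i = B x (v i) := by
  have h : B x (v i) = B (∑ j, v.repr x j • v j) (v i) := by rw [v.sum_repr]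
  rw [h]
  simp [hv, -Module.Basis.sum_repr]

theorem sum_of_orthonormal (hv : ∀ i j, B (v i) (v j) = if i = j then 1 else 0) (x : V) :
    x = ∑ i, B x (v i) • v i := by
  simp_rw [← repr_of_orthonormal hv, v.sum_repr]

theorem trace_of_orthonormal (hv : ∀ i j, B (v i) (v j) = if i = j then 1 else 0)
    (f : Module.End ℝ V) : LinearMap.trace ℝ V f = ∑ i, B (f (v i)) (v i) := by
  simp [LinearMap.trace_eq_matrix_trace ℝ v, Matrix.trace, LinearMap.toMatrix_apply,
    repr_of_orthonormal hv]

theorem sum_skew_eq_zero {M : Type*} [AddCommGroup M] [Module ℝ M]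
    (hv : ∀ i j, B (v i) (v j) = if i = j then 1 else 0)
    (A : Module.End ℝ V) (hA : ∀ x y, B (A x) y = -B (A y) x) (F : V →ₗ[ℝ] V →ₗ[ℝ] M) :
    ∑ i, (F (A (v i)) (v i) + F (v i) (A (v i))) = 0 := by
  have h1 : ∀ i, F (A (v i)) (v i) = ∑ j, B (A (v i)) (v j) • F (v j) (v i) := fun i => by
    conv_lhs => rw [sum_of_orthonormal hv (A (v i))]
    simp
  have h2 : ∀ i, F (v i) (A (v i)) = ∑ j, B (A (v i)) (v j) • F (v i) (v j) := fun i => by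
    conv_lhs => rw [sum_of_orthonormal hv (A (v i))]
    simp
  rw [Finset.sum_add_distrib, Finset.sum_congr rfl fun i _ => h1 i,
    Finset.sum_congr rfl fun i _ => h2 i, Finset.sum_comm, ← Finset.sum_add_distrib]
  refine Finset.sum_eq_zero fun i _ => ?_
  rw [← Finset.sum_add_distrib]
  refine Finset.sum_eq_zero fun j _ => ?_
  rw [hA (v j) (v i), neg_smul, neg_add_cancel]

theorem trace_mul_self_neg [FiniteDimensional ℝ V] (hsymm : ∀ x y : V, B x y = B y x)
    (hpos : ∀ x : V, x ≠ 0 → 0 < B x x) {f : Module.End ℝ V}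
    (hf : ∀ x y, B (f x) y = -B x (f y)) (hf0 : f ≠ 0) :
    LinearMap.trace ℝ V (f * f) < 0 := by
  obtain ⟨v, hv⟩ := exists_orthonormal_basis hsymm hpos
  obtain ⟨i, hi⟩ : ∃ i, f (v i) ≠ 0 := by
    by_contra! h
    exact hf0 (v.ext h)
  rw [trace_of_orthonormal hv, ← neg_pos, ← Finset.sum_neg_distrib]
  simp only [Module.End.mul_apply, hf (f _), neg_neg]
  exact Finset.sum_pos' (fun j _ => nonneg_of_posDef hpos _) ⟨i, Finset.mem_univ i, hpos _ hi⟩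

/-- An alternating form that is nondegenerate lives on an even-dimensional space. -/
theorem even_finrank_of_skew [FiniteDimensional ℝ V] (hskew : ∀ x y, B x y = -B y x)
    (hB : B.Nondegenerate) : Even (Module.finrank ℝ V) := by
  let v := Module.finBasis ℝ V
  have hdet := (nondegenerate_iff_det_ne_zero v).mp hB
  have ht : (LinearMap.BilinForm.toMatrix v B).transpose = -LinearMap.BilinForm.toMatrix v B := by
    ext i j
    simp [LinearMap.BilinForm.toMatrix_apply, hskew (v j) (v i)]
  have h := congrArg Matrix.det ht
  rw [Matrix.det_transpose, Matrix.det_neg, Fintype.card_fin] at h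
  by_contra hodd
  rw [(Nat.not_even_iff_odd.mp hodd).neg_one_pow] at h
  exact hdet (by linarith)

/-- If a commuting family of skew operators preserves a subspace and has no common kernel in it,
then the subspace is even-dimensional. -/
theorem even_finrank_of_commuting_skew [FiniteDimensional ℝ V]
    (hsymm : ∀ x y : V, B x y = B y x) (hpos : ∀ x : V, x ≠ 0 → 0 < B x x)
    (S : Set (Module.End ℝ V)) (hcomm : ∀ f ∈ S, ∀ g ∈ S, ∀ x, f (g x) = g (f x))
    (hskew : ∀ f ∈ S, ∀ x y, B (f x) y = -B x (f y)) (W : Submodule ℝ V)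
    (hinv : ∀ f ∈ S, ∀ x ∈ W, f x ∈ W) (hker : ∀ x ∈ W, (∀ f ∈ S, f x = 0) → x = 0) :
    Even (Module.finrank ℝ W) := by
  induction hn : Module.finrank ℝ W using Nat.strong_induction_on generalizing W with
  | _ n ih =>
  subst hn
  rcases eq_or_ne W ⊥ with rfl | hW
  · simp
  obtain ⟨w, hwW, hw0⟩ := W.ne_bot_iff.mp hW
  obtain ⟨f, hf, hfw⟩ : ∃ f ∈ S, f w ≠ 0 := by
    by_contra! h
    exact hw0 (hker w hwW h)
  have hrank := (f.domRestrict W).finrank_range_add_finrank_ker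
  have hrange : LinearMap.range (f.domRestrict W) = W.map f := by
    ext x
    simp
  have hkereq : Module.finrank ℝ (LinearMap.ker (f.domRestrict W)) =
      Module.finrank ℝ (W ⊓ LinearMap.ker f : Submodule ℝ V) := by
    have : (LinearMap.ker (f.domRestrict W)).map W.subtype = W ⊓ LinearMap.ker f := by
      ext x
      simp [and_comm]
    rw [← this]
    exact (LinearEquiv.finrank_eq (Submodule.equivMapOfInjective _ W.injective_subtype _))
  rw [hrange, hkereq] at hrank
  have hpos' : 0 < Module.finrank ℝ (W.map f) :=
    Module.finrank_pos_iff_exists_ne_zero.mpr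
      ⟨⟨f w, Submodule.mem_map_of_mem hwW⟩, fun h => hfw (congrArg Subtype.val h)⟩
  have hker_even := ih _ (by omega) (W ⊓ LinearMap.ker f)
    (fun g hg x hx => ⟨hinv g hg x hx.1, LinearMap.mem_ker.mpr <| by
      rw [hcomm f hf g hg, LinearMap.mem_ker.mp hx.2, map_zero]⟩)
    (fun x hx => hker x hx.1) rfl
  have hrange_even : Even (Module.finrank ℝ (W.map f)) := by
    have hsk : ∀ x y : W.map f, (B.compLeft f).restrict (W.map f) x y =
        -(B.compLeft f).restrict (W.map f) y x := fun x y => by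
      simp [hskew f hf x.1, hsymm x.1]
    refine even_finrank_of_skew hsk ?_
    have hnd : ∀ x : W.map f, (∀ y, (B.compLeft f).restrict (W.map f) x y = 0) → x = 0 := by
      rintro ⟨_, x, hx, rfl⟩ h
      have h1 : f (f x) = 0 := eq_zero_of_posDef hpos
        (h ⟨f (f x), Submodule.mem_map_of_mem (hinv f hf x hx)⟩)
      have h2 : B (f x) (f x) = 0 := by
        rw [hskew f hf, h1, map_zero, neg_zero]
      exact Subtype.ext (eq_zero_of_posDef hpos h2)
    exact ⟨hnd, fun y h => hnd y fun x => by rw [hsk, h, neg_zero]⟩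
  rw [← hrank]
  exact hrange_even.add hker_even

end LinearMap.BilinForm

namespace LieAlgebra

open LinearMap.BilinForm

/-- A cocycle with values in a faithful orthogonal representation whose range is stable is
annihilated by the representation. The proof uses the Casimir operator of the trace form. -/
theorem apply_cocycle_eq_zero {L V : Type*} [LieRing L] [LieAlgebra ℝ L] [FiniteDimensional ℝ L]
    [AddCommGroup V] [Module ℝ V] [FiniteDimensional ℝ V] {B : LinearMap.BilinForm ℝ V}
    (hsymm : ∀ x y : V, B x y = B y x) (hpos : ∀ x : V, x ≠ 0 → 0 < B x x)
    (ρ : L →ₗ[ℝ] Module.End ℝ V) (hρ : ∀ x y, ρ ⁅x, y⁆ = ρ x * ρ y - ρ y * ρ x)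
    (hinj : ∀ x, ρ x = 0 → x = 0) (hskew : ∀ x v w, B (ρ x v) w = -B v (ρ x w))
    (c : L →ₗ[ℝ] V) (hc : ∀ x y, c ⁅x, y⁆ = ρ x (c y) - ρ y (c x))
    (hrange : ∀ x y, ρ x (c y) ∈ LinearMap.range c) (x y : L) : ρ x (c y) = 0 := by
  let K : LinearMap.BilinForm ℝ L :=
    -((LinearMap.mul ℝ (Module.End ℝ V)).compr₂ (LinearMap.trace ℝ V)).compl₁₂ ρ ρ
  have hK : ∀ x y, K x y = -LinearMap.trace ℝ V (ρ x * ρ y) := fun _ _ => rfl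
  have hKsymm : ∀ x y, K x y = K y x := fun x y => by
    rw [hK, hK, LinearMap.trace_mul_comm]
  have hKpos : ∀ x, x ≠ 0 → 0 < K x x := fun x hx =>
    neg_pos.mpr (trace_mul_self_neg hsymm hpos (hskew x) (mt (hinj x) hx))
  have hKinv : ∀ z x y, K ⁅z, x⁆ y = -K ⁅z, y⁆ x := fun z x y => by
    rw [hK, hK, hρ, hρ, sub_mul, sub_mul, map_sub, map_sub, LinearMap.trace_mul_cycle ℝ (ρ z),
      LinearMap.trace_mul_cycle ℝ (ρ z), LinearMap.trace_mul_comm ℝ (ρ y * ρ z) (ρ x),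
      LinearMap.trace_mul_comm ℝ (ρ x * ρ z) (ρ y)]
    ring
  obtain ⟨e, he⟩ := exists_orthonormal_basis hKsymm hKpos
  set v₀ : V := ∑ i, ρ (e i) (c (e i)) with hv₀
  have hcas : ∀ x, ρ x v₀ = ∑ i, ρ (e i) (ρ (e i) (c x)) := fun x => by
    have h := sum_skew_eq_zero he (LieAlgebra.ad ℝ L x) (hKinv x) (ρ.compl₂ c)
    rw [hv₀, map_sum, ← sub_eq_zero, ← Finset.sum_sub_distrib, ← h]
    refine Finset.sum_congr rfl fun i _ => ?_
    simp only [LinearMap.compl₂_apply, LieAlgebra.ad_apply, hρ, hc, map_sub,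
      LinearMap.sub_apply, Module.End.mul_apply]
    abel
  have hzero : ∀ w, B (∑ i, ρ (e i) (ρ (e i) w)) w = 0 → ∀ x, ρ x w = 0 := fun w hw => by
    have h1 : ∑ i, B (ρ (e i) w) (ρ (e i) w) = 0 := by
      simpa [hskew _ (ρ _ w)] using hw
    rw [Finset.sum_eq_zero_iff_of_nonneg fun i _ => nonneg_of_posDef hpos _] at h1
    have h2 : ρ.flip w = 0 := e.ext fun i => eq_zero_of_posDef hpos (h1 i (Finset.mem_univ i))
    exact fun x => LinearMap.congr_fun h2 x
  obtain ⟨z, hz⟩ : v₀ ∈ LinearMap.range c := Submodule.sum_mem _ fun i _ => hrange _ _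
  have hv₀ρ : ∀ x, ρ x v₀ = 0 := by
    refine hzero v₀ ?_
    rw [← hz, ← hcas z, ← hz]
    have := hskew z (c z) (c z)
    rw [hsymm (c z)] at this
    linarith
  refine hzero (c y) ?_ x
  rw [← hcas, hv₀ρ, map_zero, LinearMap.zero_apply]

end LieAlgebra

open LinearMap.BilinForm

/-- **Milnor's structure theorem for flat Lie algebras.**
Let `(g, B)` be a flat Lie algebra: a finite-dimensional real Lie algebra with an inner
product `B` (a symmetric positive-definite bilinear form) such that the Levi-Civita product
`∇`, determined by `2⟨∇ₓy, z⟩ = ⟨[x,y],z⟩ + ⟨[z,x],y⟩ + ⟨[z,y],x⟩`, has zero curvature.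
Then there is an abelian Lie subalgebra `𝔰` such that `g` is the orthogonal direct sum
`𝔰 ⊕ 𝔷 ⊕ [g,g]` where `𝔷` is the center and `[g,g]` the commutator ideal; moreover `[g,g]`
is abelian of even dimension, and `[x, y] = ∇ₓ y` for all `x ∈ 𝔰 ⊕ 𝔷` and all `y ∈ g`. -/
theorem flat_lie_algebra_structure
    (g : Type*) [LieRing g] [LieAlgebra ℝ g] [Module.Finite ℝ g]
    (B : LinearMap.BilinForm ℝ g)
    (hBsymm : ∀ x y : g, B x y = B y x)
    (hBpos : ∀ x : g, x ≠ 0 → 0 < B x x)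
    (nabla : g → g → g)
    (hnabla : ∀ x y z : g,
      2 * B (nabla x y) z = B ⁅x, y⁆ z + B ⁅z, x⁆ y + B ⁅z, y⁆ x)
    (hflat : ∀ x y z : g,
      nabla ⁅x, y⁆ z = nabla x (nabla y z) - nabla y (nabla x z)) :
    ∃ 𝔰 : LieSubalgebra ℝ g, IsLieAbelian 𝔰 ∧
      (∀ x ∈ 𝔰.toSubmodule, ∀ y ∈ (LieAlgebra.center ℝ g).toSubmodule, B x y = 0) ∧
      (∀ x ∈ 𝔰.toSubmodule, ∀ y ∈ (LieAlgebra.derivedSeries ℝ g 1).toSubmodule, B x y = 0) ∧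
      (∀ x ∈ (LieAlgebra.center ℝ g).toSubmodule,
        ∀ y ∈ (LieAlgebra.derivedSeries ℝ g 1).toSubmodule, B x y = 0) ∧
      (𝔰.toSubmodule ⊔ (LieAlgebra.center ℝ g).toSubmodule ⊔
        (LieAlgebra.derivedSeries ℝ g 1).toSubmodule = ⊤) ∧
      (∀ x ∈ LieAlgebra.derivedSeries ℝ g 1, ∀ y ∈ LieAlgebra.derivedSeries ℝ g 1,
        ⁅x, y⁆ = 0) ∧
      Even (Module.finrank ℝ (LieAlgebra.derivedSeries ℝ g 1).toSubmodule) ∧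
      (∀ x ∈ 𝔰.toSubmodule ⊔ (LieAlgebra.center ℝ g).toSubmodule, ∀ y : g,
        ⁅x, y⁆ = nabla x y) := by
  have hskew : ∀ x y z, B (nabla x y) z = -B y (nabla x z) := fun x y z => by
    have h1 := hnabla x y z
    have h2 := hnabla x z y
    rw [hBsymm (nabla x z) y, ← lie_skew y z, ← lie_skew x z, ← lie_skew y x] at h2
    simp only [map_neg, LinearMap.neg_apply] at h2
    linarith
  have htor : ∀ x y, ⁅x, y⁆ = nabla x y - nabla y x := fun x y => by
    refine ext_of_posDef hBpos fun z => ?_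
    have h1 := hnabla x y z
    have h2 := hnabla y x z
    rw [← lie_skew y x] at h2
    simp only [map_neg, map_sub, LinearMap.neg_apply, LinearMap.sub_apply] at h2 ⊢
    linarith
  let N : g →ₗ[ℝ] Module.End ℝ g := LinearMap.mk₂ ℝ nabla
    (fun x x' y => ext_of_posDef hBpos fun z => by
      have h1 := hnabla x y z
      have h2 := hnabla x' y z
      have h3 := hnabla (x + x') y z
      simp only [map_add, LinearMap.add_apply, add_lie, lie_add] at h3 ⊢
      linarith)
    (fun a x y => ext_of_posDef hBpos fun z => by
      have h1 := hnabla x y z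
      have h3 := hnabla (a • x) y z
      simp only [map_smul, LinearMap.smul_apply, smul_lie, lie_smul, smul_eq_mul] at h3 ⊢
      linear_combination (1 / 2) * h3 - (a / 2) * h1)
    (fun x y y' => ext_of_posDef hBpos fun z => by
      have h1 := hnabla x y z
      have h2 := hnabla x y' z
      have h3 := hnabla x (y + y') z
      simp only [map_add, LinearMap.add_apply, lie_add] at h3 ⊢
      linarith)
    (fun a x y => ext_of_posDef hBpos fun z => by
      have h1 := hnabla x y z
      have h3 := hnabla x (a • y) z
      simp only [map_smul, LinearMap.smul_apply, lie_smul, smul_eq_mul] at h3 ⊢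
      linear_combination (1 / 2) * h3 - (a / 2) * h1)
  have hN : ∀ x y, nabla x y = N x y := fun _ _ => rfl
  simp only [hN] at hskew htor hflat ⊢
  clear_value N
  have hNlie : ∀ x y, N ⁅x, y⁆ = N x * N y - N y * N x := fun x y =>
    LinearMap.ext (hflat x y)
  set U : Submodule ℝ g := LinearMap.ker N with hU
  have hUmem : ∀ {x}, x ∈ U ↔ N x = 0 := LinearMap.mem_ker
  have hcompl : IsCompl U (B.orthogonal U) := isCompl_orthogonal_of_posDef hBsymm hBpos U
  -- The kernel of the connection is an ideal on which the connection acts by the bracket.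
  have hUlie : ∀ x, ∀ u ∈ U, ⁅x, u⁆ = N x u := fun x u hu => by
    rw [htor, hUmem.mp hu, LinearMap.zero_apply, sub_zero]
  have hUideal : ∀ x, ∀ u ∈ U, ⁅x, u⁆ ∈ U := fun x u hu => by
    rw [hUmem, hNlie, hUmem.mp hu, mul_zero, zero_mul, sub_zero]
  have hNorth : ∀ x, ∀ y ∈ B.orthogonal U, N x y ∈ B.orthogonal U := fun x y hy u hu => by
    have h : B (N x u) y = 0 := hy _ (hUlie x u hu ▸ hUideal x u hu)
    rw [hskew, neg_eq_zero] at h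
    exact h
  let b : LieSubalgebra ℝ g :=
    { B.orthogonal U with
      lie_mem' := fun {x y} hx hy => by
        show ⁅x, y⁆ ∈ B.orthogonal U
        rw [htor]
        exact sub_mem (hNorth x y hy) (hNorth y x hx) }
  have hbmem : ∀ {x}, x ∈ b ↔ x ∈ B.orthogonal U := Iff.rfl
  have hbN : ∀ x ∈ B.orthogonal U, ∀ y ∈ B.orthogonal U, N x y = 0 := fun x hx y hy =>
    LieAlgebra.apply_cocycle_eq_zero (L := b) hBsymm hBpos (N ∘ₗ b.toSubmodule.subtype)
      (fun x y => hNlie x y)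
      (fun x hx => Subtype.ext ((Submodule.disjoint_def.mp hcompl.disjoint) x.1 hx x.2))
      (fun x => hskew x) b.toSubmodule.subtype (fun x y => htor x y)
      (fun x y => ⟨⟨_, hNorth x.1 y.1 y.2⟩, rfl⟩) ⟨x, hx⟩ ⟨y, hy⟩
  have hbb : ∀ x ∈ B.orthogonal U, ∀ y ∈ B.orthogonal U, ⁅x, y⁆ = 0 := fun x hx y hy => by
    rw [htor, hbN x hx y hy, hbN y hy x hx, sub_zero]
  have hUU : ∀ x ∈ U, ∀ y ∈ U, ⁅x, y⁆ = 0 := fun x hx y hy => by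
    rw [hUlie x y hy, hUmem.mp hx, LinearMap.zero_apply]
  have hdecomp : ∀ x, ∃ u ∈ U, ∃ w ∈ B.orthogonal U, u + w = x := fun x =>
    Submodule.mem_sup.mp (hcompl.sup_eq_top ▸ Submodule.mem_top)
  have hblie : ∀ x ∈ B.orthogonal U, ∀ y, ⁅x, y⁆ = N x y := fun x hx y => by
    obtain ⟨u, hu, w, hw, rfl⟩ := hdecomp y
    rw [lie_add, map_add, hUlie x u hu, hbb x hx w hw, hbN x hx w hw]
  set Z : Submodule ℝ g := (LieAlgebra.center ℝ g).toSubmodule with hZ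
  have hZmem : ∀ {z}, z ∈ Z ↔ ∀ x : g, ⁅x, z⁆ = 0 := LieModule.mem_maxTrivSubmodule ℝ g g _
  have hZU : Z ≤ U := fun z hz => by
    obtain ⟨u, hu, w, hw, rfl⟩ := hdecomp z
    have hwU : w ∈ U := by
      refine hUmem.mpr (LinearMap.ext fun y => ?_)
      obtain ⟨u', hu', w', hw', rfl⟩ := hdecomp y
      have h := hZmem.mp hz u'
      rw [lie_add, hUU u' hu' u hu, zero_add, ← lie_skew, neg_eq_zero, hblie w hw] at h
      rw [map_add, h, hbN w hw w' hw', LinearMap.zero_apply, add_zero]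
    rw [(Submodule.disjoint_def.mp hcompl.disjoint) w hwU hw, add_zero]
    exact hu
  set D : Submodule ℝ g := (LieAlgebra.derivedSeries ℝ g 1).toSubmodule with hD
  have hDspan : D = Submodule.span ℝ {⁅x, y⁆ | (x : g) (y : g)} :=
    LieAlgebra.coe_derivedSeries_one_eq ℝ g
  have hDlie : ∀ x y : g, ⁅x, y⁆ ∈ D := fun x y =>
    hDspan ▸ Submodule.subset_span ⟨x, y, rfl⟩
  -- Every commutator is a commutator of an element of the complement with one of the ideal.
  have hDspan' : D ≤ Submodule.span ℝ {t | ∃ x ∈ B.orthogonal U, ∃ u ∈ U, ⁅x, u⁆ = t} := by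
    rw [hDspan, Submodule.span_le]
    rintro _ ⟨x, y, rfl⟩
    obtain ⟨u, hu, w, hw, rfl⟩ := hdecomp x
    obtain ⟨u', hu', w', hw', rfl⟩ := hdecomp y
    have h : ⁅u + w, u' + w'⁆ = ⁅w, u'⁆ - ⁅w', u⁆ := by
      rw [add_lie, lie_add, lie_add, hUU u hu u' hu', hbb w hw w' hw', ← lie_skew u w']
      abel
    rw [h]
    exact sub_mem (Submodule.subset_span ⟨w, hw, u', hu', rfl⟩)
      (Submodule.subset_span ⟨w', hw', u, hu, rfl⟩)
  have hDU : D ≤ U := hDspan'.trans <| Submodule.span_le.mpr <| by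
    rintro _ ⟨x, -, u, hu, rfl⟩
    exact hUideal x u hu
  have hZD : ∀ z ∈ Z, ∀ d ∈ D, B z d = 0 := fun z hz d hd => by
    suffices D ≤ LinearMap.ker (B z) from this hd
    refine hDspan'.trans (Submodule.span_le.mpr ?_)
    rintro _ ⟨x, hx, u, hu, rfl⟩
    have h := hskew x z u
    rw [← hblie x hx, hZmem.mp hz, map_zero, LinearMap.zero_apply, ← hblie x hx] at h
    exact LinearMap.mem_ker.mpr (by linarith)
  have hUsup : U ≤ Z ⊔ D := fun u hu => by
    obtain ⟨d, hd, w, hw, rfl⟩ := Submodule.mem_sup.mp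
      ((isCompl_orthogonal_of_posDef hBsymm hBpos D).sup_eq_top ▸ Submodule.mem_top (x := u))
    have hwU : w ∈ U := by simpa using sub_mem hu (hDU hd)
    refine add_comm d w ▸ Submodule.add_mem_sup (hZmem.mpr fun x => ?_) hd
    obtain ⟨u', hu', w', hw', rfl⟩ := hdecomp x
    rw [add_lie, hUU u' hu' w hwU, zero_add]
    refine ext_of_posDef hBpos fun t => ?_
    rw [hblie w' hw', hskew, ← hblie w' hw', hBsymm, hw _ (hDlie w' t)]
    simp
  refine ⟨b, ⟨fun x y => Subtype.ext (hbb x x.2 y y.2)⟩,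
    fun x hx z hz => ?_, fun x hx d hd => ?_, hZD, ?_,
    fun x hx y hy => hUU x (hDU hx) y (hDU hy), ?_, fun x hx y => ?_⟩
  · rw [hBsymm]
    exact hx z (hZU hz)
  · rw [hBsymm]
    exact hx d (hDU hd)
  · rw [sup_assoc, eq_top_iff, ← hcompl.symm.sup_eq_top]
    exact sup_le_sup le_rfl hUsup
  · refine even_finrank_of_commuting_skew hBsymm hBpos (N '' B.orthogonal U) ?_ ?_ D ?_ ?_
    · rintro _ ⟨x, hx, rfl⟩ _ ⟨y, hy, rfl⟩ z
      have h := hflat x y z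
      rw [hbb x hx y hy, map_zero, LinearMap.zero_apply] at h
      exact (sub_eq_zero.mp h.symm)
    · rintro _ ⟨x, hx, rfl⟩
      exact hskew x
    · rintro _ ⟨x, hx, rfl⟩ y -
      rw [← hblie x hx]
      exact hDlie x y
    · intro d hd h
      refine eq_zero_of_posDef hBpos (hZD d (hZmem.mpr fun x => ?_) d hd)
      obtain ⟨u, hu, w, hw, rfl⟩ := hdecomp x
      rw [add_lie, hUU u hu d (hDU hd), hblie w hw, h _ ⟨w, hw, rfl⟩, add_zero]
  · obtain ⟨w, hw, z, hz, rfl⟩ := Submodule.mem_sup.mp hx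
    rw [add_lie, hblie w hw, ← lie_skew, hZmem.mp hz, map_add, hUmem.mp (hZU hz)]
    simp
end

section
/- Every flat Lie algebra is unimodular: for every x ∈ g, the trace of the adjoint map ad_x : g → g, y ↦ [x,y], is zero. -/
/-- A positive-definite symmetric bilinear form admits a basis in which the trace of every
endomorphism is the sum of its normalized diagonal coefficients. -/
theorem exists_basis_trace_eq_sum {V : Type*} [AddCommGroup V] [Module ℝ V] [Module.Finite ℝ V]
    (B : LinearMap.BilinForm ℝ V) (hBsymm : ∀ x y : V, B x y = B y x)
    (hBpos : ∀ x : V, x ≠ 0 → 0 < B x x) :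
    ∃ b : Module.Basis (Fin (Module.finrank ℝ V)) ℝ V, ∀ T : V →ₗ[ℝ] V,
      LinearMap.trace ℝ V T = ∑ i, B (T (b i)) (b i) / B (b i) (b i) := by
  obtain ⟨b, hb⟩ := LinearMap.BilinForm.exists_orthogonal_basis (B := B) ⟨hBsymm⟩
  refine ⟨b, fun T => ?_⟩
  rw [LinearMap.trace_eq_matrix_trace ℝ b, Matrix.trace]
  refine Finset.sum_congr rfl fun i _ => ?_
  have hsum : B (T (b i)) (b i) = b.repr (T (b i)) i * B (b i) (b i) := by
    conv_lhs => rw [← b.sum_repr (T (b i))]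
    rw [map_sum, LinearMap.sum_apply, Finset.sum_eq_single i]
    · simp
    · intro j _ hj
      have hji : B (b j) (b i) = 0 := hb hj
      simp [hji]
    · simp
  rw [Matrix.diag_apply, LinearMap.toMatrix_apply, hsum,
    mul_div_cancel_right₀ _ (hBpos _ (b.ne_zero i)).ne']

/-- An endomorphism that is skew for a positive-definite symmetric form is traceless. -/
theorem trace_eq_zero_of_skew {V : Type*} [AddCommGroup V] [Module ℝ V] [Module.Finite ℝ V]
    (B : LinearMap.BilinForm ℝ V) (hBsymm : ∀ x y : V, B x y = B y x)
    (hBpos : ∀ x : V, x ≠ 0 → 0 < B x x) (T : V →ₗ[ℝ] V)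
    (hT : ∀ x, B (T x) x = 0) : LinearMap.trace ℝ V T = 0 := by
  obtain ⟨b, hb⟩ := exists_basis_trace_eq_sum B hBsymm hBpos
  simp [hb, hT]

/-- A self-adjoint endomorphism whose square is traceless vanishes. -/
theorem eq_zero_of_selfAdjoint_of_trace_sq_eq_zero {V : Type*} [AddCommGroup V] [Module ℝ V]
    [Module.Finite ℝ V] (B : LinearMap.BilinForm ℝ V) (hBsymm : ∀ x y : V, B x y = B y x)
    (hBpos : ∀ x : V, x ≠ 0 → 0 < B x x) (T : V →ₗ[ℝ] V)
    (hT : ∀ x y, B (T x) y = B x (T y)) (htr : LinearMap.trace ℝ V (T ∘ₗ T) = 0) : T = 0 := by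
  obtain ⟨b, hb⟩ := exists_basis_trace_eq_sum B hBsymm hBpos
  have hnonneg : ∀ x, 0 ≤ B x x := fun x => by
    rcases eq_or_ne x 0 with rfl | hx
    · simp
    · exact (hBpos x hx).le
  rw [hb, Finset.sum_eq_zero_iff_of_nonneg fun i _ => by
    rw [LinearMap.comp_apply, hT]
    exact div_nonneg (hnonneg _) (hnonneg _)] at htr
  refine b.ext fun i => ?_
  by_contra hne
  have hi := htr i (Finset.mem_univ i)
  rw [LinearMap.comp_apply, hT] at hi
  exact (div_pos (hBpos _ hne) (hBpos _ (b.ne_zero i))).ne' hi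


/-- **Every flat Lie algebra is unimodular.**
If `g` is a finite-dimensional real Lie algebra with an inner product `B` (symmetric
positive-definite bilinear form) whose Levi-Civita product `∇`, determined by
`2⟨∇ₓy, z⟩ = ⟨[x,y],z⟩ + ⟨[z,x],y⟩ + ⟨[z,y],x⟩`, has zero curvature, then for every `x ∈ g`
the trace of `ad x : y ↦ ⁅x, y⁆` vanishes. -/
theorem flat_lie_algebra_unimodular
    (g : Type*) [LieRing g] [LieAlgebra ℝ g] [Module.Finite ℝ g]
    (B : LinearMap.BilinForm ℝ g)
    (hBsymm : ∀ x y : g, B x y = B y x)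
    (hBpos : ∀ x : g, x ≠ 0 → 0 < B x x)
    (nabla : g → g → g)
    (hnabla : ∀ x y z : g,
      2 * B (nabla x y) z = B ⁅x, y⁆ z + B ⁅z, x⁆ y + B ⁅z, y⁆ x)
    (hflat : ∀ x y z : g,
      nabla ⁅x, y⁆ z = nabla x (nabla y z) - nabla y (nabla x z)) :
    ∀ x : g, LinearMap.trace ℝ g (LieAlgebra.ad ℝ g x) = 0 := by
  have hext : ∀ u v : g, (∀ z, 2 * B u z = 2 * B v z) → u = v := fun u v h => by
    by_contra hne
    have h0 := hBpos (u - v) (sub_ne_zero.mpr hne)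
    have h1 := h (u - v)
    rw [LinearMap.BilinForm.sub_left] at h0
    linarith
  let L : g →ₗ[ℝ] g →ₗ[ℝ] g := LinearMap.mk₂ ℝ nabla
    (fun x x' y => hext _ _ fun z => by
      simp only [map_add, LinearMap.add_apply, mul_add, hnabla, add_lie, lie_add]; ring)
    (fun c x y => hext _ _ fun z => by
      simp only [map_smul, LinearMap.smul_apply, smul_eq_mul, mul_left_comm _ c, hnabla,
        smul_lie, lie_smul]
      ring)
    (fun x y y' => hext _ _ fun z => by
      simp only [map_add, LinearMap.add_apply, mul_add, hnabla, lie_add]; ring)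
    (fun c x y => hext _ _ fun z => by
      simp only [map_smul, LinearMap.smul_apply, smul_eq_mul, mul_left_comm _ c, hnabla,
        lie_smul]
      ring)
  have hL : ∀ x y z, 2 * B (L x y) z = B ⁅x, y⁆ z + B ⁅z, x⁆ y + B ⁅z, y⁆ x := hnabla
  have hLflat : ∀ x y z, L ⁅x, y⁆ z = L x (L y z) - L y (L x z) := hflat
  have hskew : ∀ x y z, B (L x y) z = -B y (L x z) := fun x y z => by
    have h1 := hL x y z
    have h2 := hL x z y
    rw [← lie_skew z y, ← lie_skew z x, ← lie_skew x y] at h1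
    simp only [map_neg, LinearMap.neg_apply] at h1
    rw [hBsymm y]
    linarith
  have htorsion : ∀ x y, L x y - L y x = ⁅x, y⁆ := fun x y => hext _ _ fun z => by
    have h1 := hL x y z
    have h2 := hL y x z
    rw [← lie_skew y x] at h2
    simp only [map_neg, map_sub, LinearMap.sub_apply, LinearMap.neg_apply] at h2 ⊢
    linarith
  let R := L.flip
  have hcomm : ∀ x y, R (L x y) = (L x ∘ₗ R y - R y ∘ₗ L x) + R y ∘ₗ R x := fun x y => by
    ext z
    have h := hLflat x z y
    rw [← htorsion, map_sub, LinearMap.sub_apply] at h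
    simp only [R, LinearMap.add_apply, LinearMap.sub_apply, LinearMap.comp_apply,
      LinearMap.flip_apply]
    rw [sub_eq_sub_iff_add_eq_add] at h
    rw [sub_add_eq_add_sub, eq_sub_iff_add_eq, add_comm, h]
  have htrR : ∀ x y, LinearMap.trace ℝ g (R (L x y)) = LinearMap.trace ℝ g (R y ∘ₗ R x) :=
    fun x y => by
      rw [hcomm, map_add, map_sub, LinearMap.trace_comp_comm', sub_self, zero_add]
  have hBinj : Function.Injective B := fun u v h => hext u v fun z => by rw [h]
  obtain ⟨h, hh⟩ : ∃ h, B h = LinearMap.trace ℝ g ∘ₗ R :=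
    (LinearMap.injective_iff_surjective_of_finrank_eq_finrank
      Subspace.dual_finrank_eq.symm).mp hBinj _
  have hh' : ∀ x, B h x = LinearMap.trace ℝ g (R x) := fun x => by rw [hh]; rfl
  have hRh : R h = 0 := by
    refine eq_zero_of_selfAdjoint_of_trace_sq_eq_zero B hBsymm hBpos _ (fun x y => ?_) ?_
    · change B (L x h) y = B x (L y h)
      rw [hBsymm x, hskew, hskew, hh', hh', htrR, htrR, LinearMap.trace_comp_comm']
    · rw [← htrR, ← hh']
      have := hskew h h h
      rw [hBsymm] at this
      linarith
  have hzero : h = 0 := by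
    by_contra hne
    have := hBpos h hne
    rw [hh', hRh, map_zero] at this
    exact this.false
  intro x
  have had : LieAlgebra.ad ℝ g x = L x - R x := by
    ext y
    exact (htorsion x y).symm
  have hLx : LinearMap.trace ℝ g (L x) = 0 :=
    trace_eq_zero_of_skew B hBsymm hBpos _ fun y => by
      have := hskew x y y
      rw [hBsymm y] at this
      linarith
  rw [had, map_sub, hLx, ← hh', hzero, map_zero, LinearMap.zero_apply, sub_zero]
end

section
/- Let L₁,…,L_m ∈ ℝ^{k₀} be the rows of the characteristic matrix of a normal-form flat Lie algebra (no row zero, the matrix injective as a map ℝ^{k₀} → ℝ^m). The following are equivalent: (i) for every invertible linear map T : ℝ^{k₀} → ℝ^{k₀} there exist i ≠ j in {1,…,m} such that every coordinate of T(L_j) has the same square as the corresponding coordinate of T(L_i), i.e. (T(L_j))_k² = (T(L_i))_k² for all k (g is degenerate in every basis of 𝔰); (ii) there exist i ≠ j in {1,…,m} and ε ∈ {1,−1} with L_j = εL_i. -/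
/-- Finitely many vectors of `κ → K` over an infinite field can be moved by a single linear
automorphism so that the nonzero ones among them have a nonzero `k`-th coordinate, for some `k`. -/
theorem Set.Finite.exists_linearEquiv_apply_ne_zero {K κ : Type*} [Field K] [Infinite K]
    [Finite κ] [Nonempty κ] {s : Set (κ → K)} (hs : s.Finite) :
    ∃ (T : (κ → K) ≃ₗ[K] (κ → K)) (k : κ), ∀ v ∈ s, v ≠ 0 → T v k ≠ 0 := by
  classical
  let t : Set (κ → K) := insert 1 s \ {0}
  have : Finite t := (hs.insert 1).sdiff
  obtain ⟨f, hf⟩ := Module.exists_dual_forall_apply_ne_zero (K := K)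
    (fun v : t => (v : κ → K)) fun v => v.2.2
  have hf0 : f ≠ 0 := by
    rintro rfl
    exact hf ⟨1, Set.mem_insert _ _, one_ne_zero⟩ rfl
  obtain ⟨k, hk⟩ : ∃ k, f (Pi.single k 1) ≠ 0 := by
    by_contra! h
    exact hf0 (LinearMap.pi_ext' fun k => LinearMap.ext_ring (by simpa using h k))
  let g : (κ → K) →ₗ[K] (κ → K) :=
    LinearMap.pi fun l => if l = k then f else LinearMap.proj l
  have hgk (x : κ → K) : g x k = f x := by simp [g]
  have hg : Function.Injective g := by
    rw [injective_iff_map_eq_zero]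
    intro x hx
    have hxk : x = x k • Pi.single k 1 := by
      ext l
      by_cases hl : l = k
      · subst hl
        simp
      · simpa [g, hl] using congrFun hx l
    have hfx : f x = 0 := by rw [← hgk, hx, Pi.zero_apply]
    rw [hxk, map_smul, smul_eq_mul] at hfx
    rw [hxk, (mul_eq_zero.mp hfx).resolve_right hk, zero_smul]
  refine ⟨LinearEquiv.ofInjectiveEndo g hg, k, fun v hv hv0 => ?_⟩
  rw [LinearEquiv.coe_ofInjectiveEndo, hgk]
  exact hf ⟨v, Set.mem_insert_of_mem _ hv, hv0⟩


/-- let `L₁,…,L_m ∈ ℝ^{k₀}` be the rows of the characteristic matrix of a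
normal-form flat Lie algebra (no row zero, the associated map `ℝ^{k₀} → ℝ^m` injective).
Then the flat Lie algebra is degenerate in every basis of `𝔰` — i.e. for every invertible
`T : ℝ^{k₀} → ℝ^{k₀}` there are `i ≠ j` with `(T(L_j))_k² = (T(L_i))_k²` for all `k` —
iff there are `i ≠ j` and `ε = ±1` with `L_j = ε L_i`. -/
theorem degenerate_iff_proportional_rows
    (k₀ m : ℕ) (hk₀ : 1 ≤ k₀) (hk₀m : k₀ ≤ m)
    (L : Fin m → Fin k₀ → ℝ)
    (hrow : ∀ j, L j ≠ 0)
    (hinj : Function.Injective fun (a : Fin k₀ → ℝ) => fun j : Fin m => ∑ i, a i * L j i) :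
    (∀ T : (Fin k₀ → ℝ) ≃ₗ[ℝ] (Fin k₀ → ℝ),
        ∃ i j : Fin m, i ≠ j ∧ ∀ k : Fin k₀, (T (L j)) k ^ 2 = (T (L i)) k ^ 2) ↔
      ∃ i j : Fin m, i ≠ j ∧ ∃ ε : ℝ, (ε = 1 ∨ ε = -1) ∧ L j = ε • L i := by
  constructor
  · intro h
    have : Nonempty (Fin k₀) := ⟨⟨0, hk₀⟩⟩
    obtain ⟨T, k, hT⟩ := ((Set.finite_range fun p : Fin m × Fin m => L p.2 - L p.1).union
      (Set.finite_range fun p : Fin m × Fin m => L p.2 + L p.1)).exists_linearEquiv_apply_ne_zero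
    obtain ⟨i, j, hij, hsq⟩ := h T
    refine ⟨i, j, hij, ?_⟩
    rcases sq_eq_sq_iff_eq_or_eq_neg.mp (hsq k) with hk | hk
    · have hsub : L j - L i = 0 := by
        by_contra hne
        exact hT _ (.inl ⟨(i, j), rfl⟩) hne (by simp [hk])
      exact ⟨1, .inl rfl, by rw [one_smul, sub_eq_zero.mp hsub]⟩
    · have hadd : L j + L i = 0 := by
        by_contra hne
        exact hT _ (.inr ⟨(i, j), rfl⟩) hne (by simp [hk])
      exact ⟨-1, .inr rfl, by rw [neg_one_smul, eq_neg_of_add_eq_zero_left hadd]⟩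
  · rintro ⟨i, j, hij, ε, hε, h⟩ T
    refine ⟨i, j, hij, fun k => ?_⟩
    rw [h]
    rcases hε with rfl | rfl <;> simp
end
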